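/- For every positive integer n and every positive integer j, the number of compositions (c_1,…,c_t) of n satisfying c_{2i-1} > c_{2i} − (2j+1) for every index i with 2i ≤ t equals the number of compositions of n each of whose parts is either even or an odd number belonging to {1, 3, …, 2j+1}. -/

import Mathlib

/-- A composition of `n`: a list of positive integers summing to `n`. -/
def IsComposition (n : ℕ) (l : List ℕ) : Prop :=
  (∀ x ∈ l, 0 < x) ∧ l.sum = n

open PowerSeries in
/-- The generating series counting the elements of `α` by the weight `w`. -/
noncomputable def weightSeries {α : Type} (w : α → ℕ) : ℤ⟦X⟧ :=
  PowerSeries.mk fun n => (Nat.card {a // w a = n} : ℤ)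

/-- There are finitely many elements of each weight. -/
def FiniteFibers {α : Type} (w : α → ℕ) : Prop :=
  ∀ n, Finite {a // w a = n}

namespace FiniteFibers

variable {α β : Type} {w : α → ℕ} {v : β → ℕ}

theorem of_injective (h : Function.Injective w) : FiniteFibers w := fun n =>
  have : Subsingleton {a // w a = n} :=
    ⟨fun a b => Subtype.ext (h (a.2.trans b.2.symm))⟩
  inferInstance

theorem comp_injective (h : FiniteFibers w) {f : β → α} (hf : Function.Injective f) :
    FiniteFibers (fun b => w (f b)) := fun n =>
  have := h n
  Finite.of_injective (fun b : {b // w (f b) = n} => (⟨f b.1, b.2⟩ : {a // w a = n}))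
    fun _ _ hab => Subtype.ext (hf (congrArg Subtype.val hab))

theorem sumElim (hw : FiniteFibers w) (hv : FiniteFibers v) :
    FiniteFibers (Sum.elim w v) := fun n =>
  have := hw n
  have := hv n
  have : Finite ({a // Sum.elim w v (Sum.inl a) = n} ⊕ {b // Sum.elim w v (Sum.inr b) = n}) :=
    inferInstanceAs (Finite ({a // w a = n} ⊕ {b // v b = n}))
  Finite.of_equiv _ (Equiv.subtypeSum (p := fun x => Sum.elim w v x = n)).symm

end FiniteFibers

/-- Pairs of total weight `n`, sorted by the weights of their two entries. -/
def weightFiberProdEquiv {α β : Type} (w : α → ℕ) (v : β → ℕ) (n : ℕ) :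
    {p : α × β // w p.1 + v p.2 = n} ≃
      Σ q : Finset.HasAntidiagonal.antidiagonal n, {a // w a = q.1.1} × {b // v b = q.1.2} where
  toFun p := ⟨⟨(w p.1.1, v p.1.2), Finset.HasAntidiagonal.mem_antidiagonal.2 p.2⟩, ⟨p.1.1, rfl⟩, ⟨p.1.2, rfl⟩⟩
  invFun q := ⟨(q.2.1.1, q.2.2.1), by
    rw [q.2.1.2, q.2.2.2]; exact Finset.HasAntidiagonal.mem_antidiagonal.1 q.1.2⟩
  left_inv _ := rfl
  right_inv := by
    rintro ⟨⟨⟨i, j⟩, _⟩, ⟨a, ha⟩, ⟨b, hb⟩⟩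
    obtain rfl : w a = i := ha
    obtain rfl : v b = j := hb
    rfl

theorem FiniteFibers.prod {α β : Type} {w : α → ℕ} {v : β → ℕ}
    (hw : FiniteFibers w) (hv : FiniteFibers v) :
    FiniteFibers (fun p : α × β => w p.1 + v p.2) := fun n =>
  have : ∀ q : Finset.HasAntidiagonal.antidiagonal n, Finite ({a // w a = q.1.1} × {b // v b = q.1.2}) :=
    fun q => have := hw q.1.1; have := hv q.1.2; inferInstance
  Finite.of_equiv _ (weightFiberProdEquiv w v n).symm

section WeightSeries

variable {α β : Type} {w : α → ℕ} {v : β → ℕ}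

theorem weightSeries_eq_of_bijective {f : α → β} (hf : Function.Bijective f)
    (h : ∀ a, v (f a) = w a) : weightSeries w = weightSeries v := by
  ext n
  simp only [weightSeries, PowerSeries.coeff_mk, Nat.cast_inj]
  exact Nat.card_congr ((Equiv.ofBijective f hf).subtypeEquiv fun a => by simp [h])

theorem weightSeries_sumElim (hw : FiniteFibers w) (hv : FiniteFibers v) :
    weightSeries (Sum.elim w v) = weightSeries w + weightSeries v := by
  ext n
  have := hw n
  have := hv n
  simp only [weightSeries, PowerSeries.coeff_mk, map_add]
  rw [Nat.card_congr (Equiv.subtypeSum (p := fun x => Sum.elim w v x = n))]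
  exact_mod_cast Nat.card_sum (α := {a // w a = n}) (β := {b // v b = n})

theorem weightSeries_prod (hw : FiniteFibers w) (hv : FiniteFibers v) :
    weightSeries (fun p : α × β => w p.1 + v p.2) = weightSeries w * weightSeries v := by
  ext n
  have : ∀ q : Finset.HasAntidiagonal.antidiagonal n, Finite ({a // w a = q.1.1} × {b // v b = q.1.2}) :=
    fun q => have := hw q.1.1; have := hv q.1.2; inferInstance
  simp only [weightSeries, PowerSeries.coeff_mk, PowerSeries.coeff_mul]
  rw [Nat.card_congr (weightFiberProdEquiv w v n), Nat.card_sigma]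
  simp only [Nat.card_prod]
  push_cast
  exact Finset.sum_coe_sort (Finset.HasAntidiagonal.antidiagonal n)
    fun q => (Nat.card {a // w a = q.1} : ℤ) * Nat.card {b // v b = q.2}

theorem weightSeries_subtype_add_compl (hw : FiniteFibers w) (p : α → Prop) :
    weightSeries (fun a : {a // p a} => w a) + weightSeries (fun a : {a // ¬ p a} => w a) =
      weightSeries w := by
  classical
  rw [← weightSeries_sumElim (hw.comp_injective Subtype.val_injective)
    (hw.comp_injective Subtype.val_injective)]
  exact weightSeries_eq_of_bijective (Equiv.sumCompl p).bijective (by rintro (a | a) <;> rfl)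

theorem weightSeries_unit (c : ℕ) :
    weightSeries (fun _ : Unit => c) = (PowerSeries.X : PowerSeries ℤ) ^ c := by
  ext n
  simp only [weightSeries, PowerSeries.coeff_mk, PowerSeries.coeff_X_pow]
  by_cases h : c = n
  · simp [h]
  · simp [h, Ne.symm h]

end WeightSeries

theorem finiteFibers_affine (c : ℕ) {d : ℕ} (hd : 0 < d) :
    FiniteFibers (fun i : ℕ => c + d * i) :=
  .of_injective fun a b h => by simpa [hd.ne'] using h

theorem weightSeries_affine (c : ℕ) {d : ℕ} (hd : 0 < d) :
    weightSeries (fun i : ℕ => c + d * i) * (1 - PowerSeries.X ^ d) = PowerSeries.X ^ c := by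
  have hU (e : ℕ) : FiniteFibers (fun _ : Unit => e) :=
    .of_injective (Function.injective_of_subsingleton _)
  have hN := finiteFibers_affine c hd
  have key := weightSeries_eq_of_bijective
    (w := Sum.elim (fun _ : Unit => c) (fun p : Unit × ℕ => d + (c + d * p.2)))
    (v := fun i : ℕ => c + d * i) (f := Sum.elim (fun _ => 0) (fun p => p.2 + 1))
    (by
      constructor
      · rintro (a | a) (b | b) h <;> simp_all [Prod.ext_iff]
      · rintro (_ | i)
        · exact ⟨.inl (), rfl⟩
        · exact ⟨.inr ((), i), rfl⟩)
    (by rintro (a | a) <;> simp; ring)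
  rw [weightSeries_sumElim (hU c) ((hU d).prod hN),
    weightSeries_prod (hU d) hN, weightSeries_unit, weightSeries_unit] at key
  linear_combination -key

theorem finiteFibers_sum_of_pos {p : List ℕ → Prop} (hp : ∀ l, p l → ∀ x ∈ l, 0 < x) :
    FiniteFibers (fun l : {l // p l} => l.1.sum) := fun n =>
  Finite.of_injective
    (fun l : {l : {l // p l} // l.1.sum = n} =>
      (⟨l.1.1, fun h => hp _ l.1.2 _ h, l.2⟩ : Composition n))
    fun _ _ h => Subtype.ext (Subtype.ext (congrArg Composition.blocks h))

theorem card_isComposition_and (n : ℕ) (p : List ℕ → Prop) :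
    (Nat.card {l : List ℕ // IsComposition n l ∧ p l} : ℤ) =
      PowerSeries.coeff n
        (weightSeries fun l : {l : List ℕ // (∀ x ∈ l, 0 < x) ∧ p l} => l.1.sum) := by
  rw [weightSeries, PowerSeries.coeff_mk, Nat.cast_inj]
  exact Nat.card_congr
    { toFun l := ⟨⟨l.1, l.2.1.1, l.2.2⟩, l.2.1.2⟩
      invFun l := ⟨l.1.1, ⟨l.1.2.1, l.2⟩, l.1.2.2⟩
      left_inv _ := rfl
      right_inv _ := rfl }

theorem weightSeries_lists (p : ℕ → Prop) :
    weightSeries (fun l : {l : List ℕ // (∀ x ∈ l, 0 < x) ∧ ∀ x ∈ l, p x} => l.1.sum) =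
      1 + weightSeries (fun i : {i : ℕ // p (i + 1)} => 1 + 1 * i.1) *
        weightSeries
          (fun l : {l : List ℕ // (∀ x ∈ l, 0 < x) ∧ ∀ x ∈ l, p x} => l.1.sum) := by
  have hU : FiniteFibers (fun _ : Unit => 0) :=
    .of_injective (Function.injective_of_subsingleton _)
  have hP : FiniteFibers (fun i : {i : ℕ // p (i + 1)} => 1 + 1 * i.1) :=
    (finiteFibers_affine 1 one_pos).comp_injective Subtype.val_injective
  have hL := finiteFibers_sum_of_pos
    (p := fun l => (∀ x ∈ l, 0 < x) ∧ ∀ x ∈ l, p x) fun _ h => h.1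
  rw [← weightSeries_prod hP hL, ← pow_zero PowerSeries.X, ← weightSeries_unit,
    ← weightSeries_sumElim hU (hP.prod hL)]
  symm
  refine weightSeries_eq_of_bijective
    (f := Sum.elim (fun _ => ⟨[], by simp⟩)
      (fun q => ⟨(q.1.1 + 1) :: q.2.1, by simpa using q.2.2.1, by
        simpa using ⟨q.1.2, q.2.2.2⟩⟩)) ⟨?_, ?_⟩ ?_
  · rintro (a | ⟨⟨a, ha⟩, ⟨l, hl⟩⟩) (b | ⟨⟨b, hb⟩, ⟨m, hm⟩⟩) h <;> simp_all
  · rintro ⟨_ | ⟨_ | a, l⟩, h1, h2⟩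
    · exact ⟨.inl (), rfl⟩
    · simp at h1
    · simp only [List.forall_mem_cons] at h1 h2
      exact ⟨.inr (⟨a, h2.1⟩, ⟨l, h1.2, h2.2⟩), rfl⟩
  · rintro (a | a) <;> simp; ring

/-- Every pair of entries `c_{2i-1}, c_{2i}` satisfies `c_{2i} < c_{2i-1} + k`. -/
def PairwiseBounded (k : ℕ) (l : List ℕ) : Prop :=
  ∀ i : ℕ, 2 * i + 1 < l.length → l.getD (2 * i + 1) 0 < l.getD (2 * i) 0 + k

theorem pairwiseBounded_nil (k : ℕ) : PairwiseBounded k [] := by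
  simp [PairwiseBounded]

theorem pairwiseBounded_singleton (k a : ℕ) : PairwiseBounded k [a] := by
  simp [PairwiseBounded]

theorem pairwiseBounded_cons_cons {k a b : ℕ} {l : List ℕ} :
    PairwiseBounded k (a :: b :: l) ↔ b < a + k ∧ PairwiseBounded k l := by
  constructor
  · intro h
    refine ⟨by simpa using h 0 (by simp), fun i hi => ?_⟩
    simpa [Nat.mul_add] using h (i + 1) (by simp; omega)
  · rintro ⟨h, hl⟩ (_ | i) hi
    · simpa using h
    · simpa [Nat.mul_add] using hl i (by simp at hi; omega)

theorem weightSeries_pairwiseBounded (k : ℕ) :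
    weightSeries
        (fun l : {l : List ℕ // (∀ x ∈ l, 0 < x) ∧ PairwiseBounded k l} => l.1.sum) =
      1 + weightSeries (fun i : ℕ => 1 + 1 * i) +
        weightSeries (fun q : {q : ℕ × ℕ // q.2 < q.1 + k} =>
          (1 + 1 * q.1.1) + (1 + 1 * q.1.2)) *
        weightSeries
          (fun l : {l : List ℕ // (∀ x ∈ l, 0 < x) ∧ PairwiseBounded k l} => l.1.sum) := by
  have hU : FiniteFibers (fun _ : Unit => 0) :=
    .of_injective (Function.injective_of_subsingleton _)
  have hN := finiteFibers_affine 1 one_pos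
  have hP : FiniteFibers (fun q : {q : ℕ × ℕ // q.2 < q.1 + k} =>
      (1 + 1 * q.1.1) + (1 + 1 * q.1.2)) :=
    (hN.prod hN).comp_injective Subtype.val_injective
  have hL := finiteFibers_sum_of_pos
    (p := fun l => (∀ x ∈ l, 0 < x) ∧ PairwiseBounded k l) fun _ h => h.1
  rw [← weightSeries_prod hP hL, ← pow_zero PowerSeries.X, ← weightSeries_unit,
    ← weightSeries_sumElim hU hN, ← weightSeries_sumElim (hU.sumElim hN) (hP.prod hL)]
  symm
  refine weightSeries_eq_of_bijective
    (f := Sum.elim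
      (Sum.elim (fun _ => ⟨[], by simp, pairwiseBounded_nil k⟩)
        (fun i => ⟨[i + 1], by simp, pairwiseBounded_singleton k _⟩))
      (fun q => ⟨(q.1.1.1 + 1) :: (q.1.1.2 + 1) :: q.2.1, by simpa using q.2.2.1,
        pairwiseBounded_cons_cons.2 ⟨by have := q.1.2; omega, q.2.2.2⟩⟩)) ⟨?_, ?_⟩ ?_
  · rintro ((a | a) | ⟨⟨⟨a, a'⟩, ha⟩, ⟨l, hl⟩⟩) ((b | b) | ⟨⟨⟨b, b'⟩, hb⟩, ⟨m, hm⟩⟩) h <;>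
      simp_all
  · rintro ⟨_ | ⟨_ | a, _ | ⟨_ | b, l⟩⟩, h1, h2⟩
    · exact ⟨.inl (.inl ()), rfl⟩
    · simp at h1
    · simp at h1
    · simp at h1
    · exact ⟨.inl (.inr a), rfl⟩
    · simp at h1
    · simp only [List.forall_mem_cons] at h1
      rw [pairwiseBounded_cons_cons] at h2
      exact ⟨.inr (⟨(a, b), by have := h2.1; omega⟩, ⟨l, h1.2.2, h2.2⟩), rfl⟩
  · rintro ((a | a) | a) <;> simp <;> ring

theorem weightSeries_pairs_add (k : ℕ) :
    weightSeries (fun q : {q : ℕ × ℕ // q.2 < q.1 + k} =>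
        (1 + 1 * q.1.1) + (1 + 1 * q.1.2)) +
      weightSeries (fun i : ℕ => 2 + 2 * i) * weightSeries (fun i : ℕ => k + 1 * i) =
    weightSeries (fun i : ℕ => 1 + 1 * i) * weightSeries (fun i : ℕ => 1 + 1 * i) := by
  have hN := finiteFibers_affine 1 one_pos
  rw [← weightSeries_prod hN hN,
    ← weightSeries_subtype_add_compl (hN.prod hN) (fun q : ℕ × ℕ => q.2 < q.1 + k),
    ← weightSeries_prod (finiteFibers_affine 2 two_pos) (finiteFibers_affine k one_pos)]
  congr 1
  refine weightSeries_eq_of_bijective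
    (f := fun q => ⟨(q.1, q.1 + k + q.2), by simp⟩) ⟨?_, ?_⟩ ?_
  · rintro ⟨a, b⟩ ⟨c, d⟩ h
    simp only [Subtype.mk.injEq, Prod.mk.injEq] at h ⊢
    omega
  · rintro ⟨⟨a, b⟩, h⟩
    refine ⟨(a, b - (a + k)), Subtype.ext (Prod.ext rfl ?_)⟩
    simp only [not_lt] at h ⊢
    omega
  · intro q
    ring

theorem weightSeries_even_or_bounded_odd_add (j : ℕ) :
    weightSeries (fun i : {i : ℕ // Even (i + 1) ∨ (Odd (i + 1) ∧ i + 1 ≤ 2 * j + 1)} =>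
        1 + 1 * i.1) +
      weightSeries (fun i : ℕ => (2 * j + 3) + 2 * i) =
    weightSeries (fun i : ℕ => 1 + 1 * i) := by
  rw [← weightSeries_subtype_add_compl (finiteFibers_affine 1 one_pos)
    (fun i : ℕ => Even (i + 1) ∨ (Odd (i + 1) ∧ i + 1 ≤ 2 * j + 1))]
  congr 1
  refine weightSeries_eq_of_bijective
    (f := fun i => ⟨2 * j + 2 + 2 * i, by
      rw [Nat.even_iff, Nat.odd_iff]; omega⟩) ⟨?_, ?_⟩ ?_
  · intro a b h
    simpa using h
  · rintro ⟨i, h⟩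
    rw [Nat.even_iff, Nat.odd_iff] at h
    exact ⟨(i - (2 * j + 2)) / 2, Subtype.ext (by simp only; omega)⟩
  · intro i
    simp only
    ring

open PowerSeries in
theorem eq_of_series_equations {A B E L P Q R S : ℤ⟦X⟧} {j : ℕ}
    (hA : A * (1 - X ^ 1) = X ^ 1) (hB : B * (1 - X ^ 2) = X ^ (2 * j + 3))
    (hE : E * (1 - X ^ 2) = X ^ 2) (hS : S * (1 - X ^ 1) = X ^ (2 * j + 1))
    (hQ : Q + B = A) (hR : R = 1 + Q * R) (hP : P + E * S = A * A)
    (hL : L = 1 + A + P * L) : L = R := by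
  set D : ℤ⟦X⟧ := 1 - X - 2 * X ^ 2 + X ^ (2 * j + 3) with hD
  have hD0 : D ≠ 0 := by
    intro h
    have := congrArg (constantCoeff (R := ℤ)) h
    simp [hD] at this
  have hDQ : D = (1 - X ^ 2) * (1 - Q) := by
    linear_combination hD - hB + (1 + X) * hA + (1 - X ^ 2) * hQ
  have hDP : D = (1 - X ^ 2) * (1 - X) * (1 - P) := by
    linear_combination hD + (1 - X ^ 2) * (1 - X) * hP
      + (1 + X) * (X + A * (1 - X)) * hA - S * (1 - X) * hE - X ^ 2 * hS
  refine mul_left_cancel₀ hD0 ?_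
  linear_combination L * hDP - R * hDQ + (1 - X ^ 2) * (1 - X) * hL
    - (1 - X ^ 2) * hR + (1 - X ^ 2) * hA

/-- For positive `n` and `j`, the number of compositions of `n` with
`c_{2i-1} > c_{2i} - (2j+1)` for each pair equals the number of compositions
of `n` whose parts are all even or odd numbers in `{1, 3, …, 2j+1}`. -/
theorem arndt_neg_odd_count (n j : ℕ) (hn : 0 < n) (hj : 0 < j) :
    Nat.card {l : List ℕ // IsComposition n l ∧
        ∀ i : ℕ, 2 * i + 1 < l.length →
          l.getD (2 * i + 1) 0 < l.getD (2 * i) 0 + (2 * j + 1)} =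
      Nat.card {l : List ℕ // IsComposition n l ∧
        ∀ x ∈ l, Even x ∨ (Odd x ∧ x ≤ 2 * j + 1)} := by
  have h := eq_of_series_equations (j := j)
    (weightSeries_affine 1 one_pos) (weightSeries_affine (2 * j + 3) two_pos)
    (weightSeries_affine 2 two_pos) (weightSeries_affine (2 * j + 1) one_pos)
    (weightSeries_even_or_bounded_odd_add j)
    (weightSeries_lists fun x => Even x ∨ (Odd x ∧ x ≤ 2 * j + 1))
    (weightSeries_pairs_add (2 * j + 1))
    (weightSeries_pairwiseBounded (2 * j + 1))
  have hcard := congrArg (PowerSeries.coeff n) h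
  rw [← card_isComposition_and, ← card_isComposition_and] at hcard
  exact_mod_cast hcard
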